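/- arXiv:2302.07933 — 2 statements merged into one kernel-verified Lean document; each statement's English description precedes it below -/
import Mathlib

section
/- Let f : ℝ² → ℝ be twice continuously differentiable and nonnegative, let S ⊆ ℝ² be a convex set, let w_c ∈ S, and let H ∈ ℝ^{2×2} be a matrix such that for every w' ∈ S and all indices k, l ∈ {1,2}, the (k,l) entry of the Hessian of f at w' satisfies (Hess f(w'))_{kl} ≤ H_{kl}. Suppose moreover that either (w − w_c)ₖ ≥ 0 for all w ∈ S and both k, or (w − w_c)ₖ ≤ 0 for all w ∈ S and both k. Then for all w ∈ S: f(w) ≤ f(w_c) + Df(w_c)·(w − w_c) + ½ (w − w_c)ᵀ H (w − w_c). -/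
open Matrix

/-- Second-order Taylor upper bound on `[0, 1]` from an upper bound on the second derivative. -/
theorem le_taylor_two_of_second_deriv_le {g g' g'' : ℝ → ℝ} {c : ℝ}
    (hg : ∀ t, HasDerivAt g (g' t) t) (hg' : ∀ t, HasDerivAt g' (g'' t) t)
    (hc : ∀ t ∈ Set.Icc (0 : ℝ) 1, g'' t ≤ c) :
    g 1 ≤ g 0 + g' 0 + (1 / 2) * c := by
  have hlin : ∀ t ∈ Set.Icc (0 : ℝ) 1, g' t ≤ g' 0 + c * t := by
    refine image_le_of_deriv_right_le_deriv_boundary (f' := g'') (B' := fun _ => c)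
      (fun t _ => (hg' t).continuousAt.continuousWithinAt)
      (fun t _ => (hg' t).hasDerivWithinAt) (by simp) (by fun_prop)
      (fun t _ => HasDerivAt.hasDerivWithinAt ?_)
      (fun t ht => hc t (Set.Ico_subset_Icc_self ht))
    simpa using ((hasDerivAt_id t).const_mul c).const_add (g' 0)
  have hquad : ∀ t ∈ Set.Icc (0 : ℝ) 1, g t ≤ g 0 + g' 0 * t + (1 / 2) * c * t ^ 2 := by
    refine image_le_of_deriv_right_le_deriv_boundary (f' := g')
      (B' := fun t => g' 0 + c * t)
      (fun t _ => (hg t).continuousAt.continuousWithinAt)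
      (fun t _ => (hg t).hasDerivWithinAt) (by simp) (by fun_prop)
      (fun t _ => HasDerivAt.hasDerivWithinAt ?_)
      (fun t ht => hlin t (Set.Ico_subset_Icc_self ht))
    convert (((hasDerivAt_id t).const_mul (g' 0)).const_add (g 0)).add
      ((hasDerivAt_pow 2 t).const_mul ((1 / 2) * c)) using 1
    · ext y
      simp
    · simp
      ring
  simpa using hquad 1 (by simp)

/-- A bilinear form whose matrix entries are bounded by those of `H` is bounded by the quadratic
form of `H` at vectors whose coordinates have pairwise nonnegative products. -/
theorem bilin_self_le_dotProduct_mulVec {n : Type*} [Fintype n] [DecidableEq n]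
    (B : (n → ℝ) →L[ℝ] (n → ℝ) →L[ℝ] ℝ) (H : Matrix n n ℝ)
    (hB : ∀ k l, B (Pi.single k 1) (Pi.single l 1) ≤ H k l)
    (v : n → ℝ) (hv : ∀ k l, 0 ≤ v k * v l) :
    B v v ≤ v ⬝ᵥ H.mulVec v := by
  have hexp : B v v = ∑ k, ∑ l, v k * v l * B (Pi.single k 1) (Pi.single l 1) := by
    conv_lhs => rw [pi_eq_sum_univ' v]
    simp only [map_sum, map_smul, _root_.sum_apply, _root_.smul_apply,
      smul_eq_mul, Finset.mul_sum, mul_assoc]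
    rw [Finset.sum_comm]
    simp [mul_left_comm]
  rw [hexp]
  simp only [dotProduct, mulVec, Finset.mul_sum]
  refine Finset.sum_le_sum fun k _ => Finset.sum_le_sum fun l _ => ?_
  calc v k * v l * B (Pi.single k 1) (Pi.single l 1) ≤ v k * v l * H k l :=
        mul_le_mul_of_nonneg_left (hB k l) (hv k l)
    _ = v k * (H k l * v l) := by ring

/-- Integrand relaxation (over-approximation): if every entry of the Hessian of the
nonnegative `C²` function `f` is bounded above on the convex set `S` by the
corresponding entry of `H`, and all coordinates of `w − w_c` have a uniform sign on
`S`, then the quadratic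
`f(w_c) + Df(w_c)(w − w_c) + ½ (w − w_c)ᵀ H (w − w_c)` over-approximates `f` on `S`. -/
theorem integrand_relaxation_upper (f : (Fin 2 → ℝ) → ℝ)
    (hf : ContDiff ℝ 2 f) (hf0 : ∀ w, 0 ≤ f w)
    (S : Set (Fin 2 → ℝ)) (hS : Convex ℝ S) (wc : Fin 2 → ℝ) (hwc : wc ∈ S)
    (H : Matrix (Fin 2) (Fin 2) ℝ)
    (hH : ∀ w' ∈ S, ∀ k l,
      fderiv ℝ (fderiv ℝ f) w' (Pi.single k 1) (Pi.single l 1) ≤ H k l)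
    (hsign : (∀ w ∈ S, ∀ k, 0 ≤ w k - wc k) ∨ (∀ w ∈ S, ∀ k, w k - wc k ≤ 0)) :
    ∀ w ∈ S, f w ≤ f wc + fderiv ℝ f wc (w - wc) +
      (1/2) * ((w - wc) ⬝ᵥ H.mulVec (w - wc)) := by
  intro w hw
  have hv : ∀ k l, 0 ≤ (w - wc) k * (w - wc) l := fun k l => by
    rcases hsign with h | h
    · exact mul_nonneg (h w hw k) (h w hw l)
    · exact mul_nonneg_of_nonpos_of_nonpos (h w hw k) (h w hw l)
  have hline : ∀ t : ℝ, HasDerivAt (fun t : ℝ => wc + t • (w - wc)) (w - wc) t := fun t => by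
    simpa using ((hasDerivAt_id t).smul_const (w - wc)).const_add wc
  have hf' : Differentiable ℝ (fderiv ℝ f) :=
    (hf.fderiv_right (m := 1) (by norm_num)).differentiable (by norm_num)
  have htaylor := le_taylor_two_of_second_deriv_le
    (g := fun t => f (wc + t • (w - wc)))
    (g' := fun t => fderiv ℝ f (wc + t • (w - wc)) (w - wc))
    (g'' := fun t => fderiv ℝ (fderiv ℝ f) (wc + t • (w - wc)) (w - wc) (w - wc))
    (c := (w - wc) ⬝ᵥ H.mulVec (w - wc))
    (fun t => (hf.differentiable (by norm_num) _).hasFDerivAt.comp_hasDerivAt t (hline t))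
    (fun t => by
      simpa using ((hf' _).hasFDerivAt.comp_hasDerivAt t (hline t)).clm_apply
        (hasDerivAt_const t (w - wc)))
    (fun t ht => bilin_self_le_dotProduct_mulVec _ H
      (hH _ (hS.add_smul_sub_mem hwc hw ht)) _ hv)
  simpa using htaylor
end

section
/- Let f : ℝ² → ℝ be twice continuously differentiable and nonnegative, let S ⊆ ℝ² be a convex set, let w_c ∈ S, and let H ∈ ℝ^{2×2} be a matrix such that for every w' ∈ S and all indices k, l ∈ {1,2}, the (k,l) entry of the Hessian of f at w' satisfies H_{kl} ≤ (Hess f(w'))_{kl}. Suppose moreover that either (w − w_c)ₖ ≥ 0 for all w ∈ S and both k, or (w − w_c)ₖ ≤ 0 for all w ∈ S and both k. Then for all w ∈ S: f(w) ≥ f(w_c) + Df(w_c)·(w − w_c) + ½ (w − w_c)ᵀ H (w − w_c). -/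
open Matrix

/-- Second-order Taylor lower bound along the segment from `x` to `x + v`. -/
theorem ContDiff.add_fderiv_add_half_le {E : Type*} [NormedAddCommGroup E] [NormedSpace ℝ E]
    {f : E → ℝ} (hf : ContDiff ℝ 2 f) {x v : E} {c : ℝ}
    (hc : ∀ t ∈ Set.Icc (0 : ℝ) 1, c ≤ fderiv ℝ (fderiv ℝ f) (x + t • v) v v) :
    f x + fderiv ℝ f x v + (1 / 2) * c ≤ f (x + v) := by
  have hf' : Differentiable ℝ (fderiv ℝ f) :=
    (hf.fderiv_right (m := 1) (by norm_num)).differentiable (by norm_num)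
  have hline (t : ℝ) : HasDerivAt (fun t : ℝ => x + t • v) v t := by
    simpa using ((hasDerivAt_id t).smul_const v).const_add x
  have hd1 (t : ℝ) : HasDerivAt (fun t : ℝ => f (x + t • v)) (fderiv ℝ f (x + t • v) v) t :=
    ((hf.differentiable (by norm_num)) _).hasFDerivAt.comp_hasDerivAt t (hline t)
  have hd2 (t : ℝ) : HasDerivAt (fun t : ℝ => fderiv ℝ f (x + t • v) v)
      (fderiv ℝ (fderiv ℝ f) (x + t • v) v v) t := by
    simpa using ((hf' _).hasFDerivAt.comp_hasDerivAt t (hline t)).clm_apply (hasDerivAt_const t v)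
  have hq1 (t : ℝ) : HasDerivAt (fun t : ℝ => fderiv ℝ f x v + t * c) c t := by
    simpa using ((hasDerivAt_id t).mul_const c).const_add (fderiv ℝ f x v)
  have hq2 (t : ℝ) : HasDerivAt (fun t : ℝ => f x + (t * fderiv ℝ f x v + t ^ 2 * (c / 2)))
      (fderiv ℝ f x v + t * c) t := by
    have h := (((hasDerivAt_id t).mul_const (fderiv ℝ f x v)).add
      ((hasDerivAt_pow 2 t).mul_const (c / 2))).const_add (f x)
    exact h.congr_deriv (by push_cast; ring)
  have hslope : ∀ ⦃t⦄, t ∈ Set.Icc (0 : ℝ) 1 →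
      fderiv ℝ f x v + t * c ≤ fderiv ℝ f (x + t • v) v :=
    image_le_of_deriv_right_le_deriv_boundary
      (fun t _ => (hq1 t).continuousAt.continuousWithinAt) (fun t _ => (hq1 t).hasDerivWithinAt)
      (by simp) (fun t _ => (hd2 t).continuousAt.continuousWithinAt)
      (fun t _ => (hd2 t).hasDerivWithinAt) (fun t ht => hc t ⟨ht.1, ht.2.le⟩)
  have hvalue : ∀ ⦃t⦄, t ∈ Set.Icc (0 : ℝ) 1 →
      f x + (t * fderiv ℝ f x v + t ^ 2 * (c / 2)) ≤ f (x + t • v) :=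
    image_le_of_deriv_right_le_deriv_boundary
      (fun t _ => (hq2 t).continuousAt.continuousWithinAt) (fun t _ => (hq2 t).hasDerivWithinAt)
      (by simp) (fun t _ => (hd1 t).continuousAt.continuousWithinAt)
      (fun t _ => (hd1 t).hasDerivWithinAt) (fun t ht => hslope ⟨ht.1, ht.2.le⟩)
  have h := hvalue (Set.right_mem_Icc.2 zero_le_one)
  simp only [one_smul] at h
  linarith

/-- An entrywise lower bound on a bilinear form gives a lower bound on its values at vectors
whose coordinates have pairwise nonnegative products. -/
theorem Matrix.dotProduct_mulVec_le_of_entry_le {ι : Type*} [Fintype ι] [DecidableEq ι]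
    {H : Matrix ι ι ℝ} {B : (ι → ℝ) →L[ℝ] (ι → ℝ) →L[ℝ] ℝ}
    (hH : ∀ k l, H k l ≤ B (Pi.single k 1) (Pi.single l 1))
    {v : ι → ℝ} (hv : ∀ k l, 0 ≤ v k * v l) :
    v ⬝ᵥ H.mulVec v ≤ B v v := by
  have hB : B v v = ∑ k, ∑ l, v k * v l * B (Pi.single k 1) (Pi.single l 1) := by
    conv_lhs => rw [pi_eq_sum_univ' v]
    simp only [map_sum, map_smul, _root_.sum_apply, _root_.smul_apply,
      smul_eq_mul, Finset.mul_sum, mul_assoc]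
    rw [Finset.sum_comm]
    exact Finset.sum_congr rfl fun k _ => Finset.sum_congr rfl fun l _ => by ring
  rw [hB]
  simp only [dotProduct, mulVec, Finset.mul_sum]
  refine Finset.sum_le_sum fun k _ => Finset.sum_le_sum fun l _ => ?_
  linarith [mul_le_mul_of_nonneg_left (hH k l) (hv k l)]

/-- Integrand relaxation (under-approximation): if every entry of the Hessian of the
nonnegative `C²` function `f` is bounded below on the convex set `S` by the
corresponding entry of `H`, and all coordinates of `w − w_c` have a uniform sign on
`S`, then the quadratic
`f(w_c) + Df(w_c)(w − w_c) + ½ (w − w_c)ᵀ H (w − w_c)` under-approximates `f` on `S`. -/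
theorem integrand_relaxation_lower (f : (Fin 2 → ℝ) → ℝ)
    (hf : ContDiff ℝ 2 f) (hf0 : ∀ w, 0 ≤ f w)
    (S : Set (Fin 2 → ℝ)) (hS : Convex ℝ S) (wc : Fin 2 → ℝ) (hwc : wc ∈ S)
    (H : Matrix (Fin 2) (Fin 2) ℝ)
    (hH : ∀ w' ∈ S, ∀ k l,
      H k l ≤ fderiv ℝ (fderiv ℝ f) w' (Pi.single k 1) (Pi.single l 1))
    (hsign : (∀ w ∈ S, ∀ k, 0 ≤ w k - wc k) ∨ (∀ w ∈ S, ∀ k, w k - wc k ≤ 0)) :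
    ∀ w ∈ S, f wc + fderiv ℝ f wc (w - wc) +
      (1/2) * ((w - wc) ⬝ᵥ H.mulVec (w - wc)) ≤ f w := by
  intro w hw
  have hprod (k l : Fin 2) : 0 ≤ (w - wc) k * (w - wc) l := by
    rcases hsign with h | h
    · exact mul_nonneg (h w hw k) (h w hw l)
    · exact mul_nonneg_of_nonpos_of_nonpos (h w hw k) (h w hw l)
  have h := hf.add_fderiv_add_half_le (x := wc) (v := w - wc) fun t ht =>
    dotProduct_mulVec_le_of_entry_le (hH _ (hS.add_smul_sub_mem hwc hw ht)) hprod
  rwa [add_sub_cancel] at h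
end
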